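/- arXiv:1903.11142 — 3 statements merged into one kernel-verified Lean document; each statement's English description precedes it below -/
import Mathlib

section
/- Fix λ₀ > 0 and a probability mass function p₀ : ℕ → ℝ with p₀(0) = 0; set ν₀ = λ₀p₀, q₀ = exp(λ₀(p₀ − δ₀)) and r₀ = exp(−λ₀(p₀ − δ₀)). Let Π be any probability measure on the set of pairs (λ, p) with λ > 0 and p a probability mass function on ℕ with p(0)=0, and write q_{λ,p} = exp(λ(p − δ₀)) and ν = λp. Then for every ε ∈ (0, 1], Π({(λ,p) : ‖ν − ν₀‖₁ ≥ ε}) ≤ 2 Π({(λ,p) : ‖q_{λ,p} − q₀‖₁ ≥ ε/(2‖r₀‖₁)}). -/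
open MeasureTheory
open scoped BigOperators Classical

noncomputable section

/-- Discrete convolution of two sequences. -/
def conv (a b : ℕ → ℝ) : ℕ → ℝ := fun i => ∑ k ∈ Finset.range (i + 1), a k * b (i - k)

/-- The sequence δ₀ with δ₀(0) = 1 and δ₀(k) = 0 for k ≥ 1. -/
def delta0 : ℕ → ℝ := fun i => if i = 0 then 1 else 0

/-- Convolution powers: a^{∗0} = δ₀, a^{∗(n+1)} = a^{∗n} ∗ a. -/
def convPow (a : ℕ → ℝ) : ℕ → ℕ → ℝ
  | 0 => delta0
  | n + 1 => conv (convPow a n) a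

/-- The ℓ¹ norm of a sequence. -/
def l1 (a : ℕ → ℝ) : ℝ := ∑' i, |a i|

/-- exp(a) = ∑_{j=0}^∞ a^{∗j}/j!, defined coordinatewise. -/
def expSeq (a : ℕ → ℝ) : ℕ → ℝ := fun i => ∑' j, convPow a j i / (Nat.factorial j : ℝ)

/-- p is a probability mass function on ℕ₀. -/
def IsPMF (p : ℕ → ℝ) : Prop := (∀ i, 0 ≤ p i) ∧ ∑' i, p i = 1

/-- Kullback–Leibler divergence. -/
def KL (u v : ℕ → ℝ) : ℝ := ∑' i, u i * Real.log (u i / v i)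

/-- The V divergence. -/
def Vd (u v : ℕ → ℝ) : ℝ := ∑' i, u i * (Real.log (u i / v i)) ^ 2

/-- Squared Hellinger distance. -/
def hellSq (u v : ℕ → ℝ) : ℝ := ∑' i, (Real.sqrt (u i) - Real.sqrt (v i)) ^ 2

/-- Hellinger distance. -/
def hell (u v : ℕ → ℝ) : ℝ := Real.sqrt (hellSq u v)

/-- The compound Poisson distribution of (λ, p). -/
def cpq (lam : ℝ) (p : ℕ → ℝ) : ℕ → ℝ :=
  fun i => ∑' n, Real.exp (-lam) * lam ^ n / (Nat.factorial n : ℝ) * convPow p n i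

/-- The value at `x` of the generating function of a sequence. -/
def genFun (a : ℕ → ℝ) (x : ℝ) : ℝ := ∑' i, a i * x ^ i

/-- The series `∑ c j • a^{∗j}`, defined coordinatewise. -/
def convSeries (c a : ℕ → ℝ) : ℕ → ℝ := fun i => ∑' j, c j * convPow a j i

lemma l1_nonneg (a : ℕ → ℝ) : 0 ≤ l1 a := tsum_nonneg fun _ => abs_nonneg _

lemma summable_abs_mul_pow {a : ℕ → ℝ} (ha : Summable fun i => |a i|) {x : ℝ} (hx : |x| ≤ 1) :
    Summable fun i => |a i * x ^ i| := by
  refine Summable.of_nonneg_of_le (fun _ => abs_nonneg _) (fun i => ?_) ha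
  rw [abs_mul, abs_pow]
  exact mul_le_of_le_one_right (abs_nonneg _) (pow_le_one₀ (abs_nonneg _) hx)

lemma abs_genFun_le {a : ℕ → ℝ} (ha : Summable fun i => |a i|) {x : ℝ} (hx : |x| ≤ 1) :
    |genFun a x| ≤ l1 a := by
  have h := summable_abs_mul_pow ha hx
  refine (norm_tsum_le_tsum_norm (f := fun i => a i * x ^ i) h).trans ?_
  refine h.tsum_le_tsum (fun i => ?_) ha
  rw [Real.norm_eq_abs, abs_mul, abs_pow]
  exact mul_le_of_le_one_right (abs_nonneg _) (pow_le_one₀ (abs_nonneg _) hx)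

lemma abs_conv_le (a b : ℕ → ℝ) (i : ℕ) :
    |conv a b i| ≤ ∑ k ∈ Finset.range (i + 1), |a k| * |b (i - k)| := by
  refine (Finset.abs_sum_le_sum_abs _ _).trans (le_of_eq ?_)
  simp only [abs_mul]

lemma summable_abs_conv {a b : ℕ → ℝ} (ha : Summable fun i => |a i|)
    (hb : Summable fun i => |b i|) : Summable fun i => |conv a b i| :=
  summable_norm_sum_mul_range_of_summable_norm (f := a) (g := b) ha hb

lemma l1_conv_le {a b : ℕ → ℝ} (ha : Summable fun i => |a i|) (hb : Summable fun i => |b i|) :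
    l1 (conv a b) ≤ l1 a * l1 b := by
  have ha' : Summable fun i => ‖|a i|‖ := by simpa using ha
  have hb' : Summable fun i => ‖|b i|‖ := by simpa using hb
  unfold l1
  rw [tsum_mul_tsum_eq_tsum_sum_range_of_summable_norm ha' hb']
  exact (summable_abs_conv ha hb).tsum_le_tsum (abs_conv_le a b)
    (summable_norm_sum_mul_range_of_summable_norm ha' hb').of_norm

lemma genFun_conv {a b : ℕ → ℝ} (ha : Summable fun i => |a i|) (hb : Summable fun i => |b i|)
    {x : ℝ} (hx : |x| ≤ 1) : genFun (conv a b) x = genFun a x * genFun b x := by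
  unfold genFun
  rw [tsum_mul_tsum_eq_tsum_sum_range_of_summable_norm (f := fun i => a i * x ^ i)
    (g := fun i => b i * x ^ i) (summable_abs_mul_pow ha hx) (summable_abs_mul_pow hb hx)]
  refine tsum_congr fun i => ?_
  rw [conv, Finset.sum_mul]
  refine Finset.sum_congr rfl fun k hk => ?_
  have hki : k + (i - k) = i := Nat.add_sub_cancel' (Finset.mem_range_succ_iff.mp hk)
  calc a k * b (i - k) * x ^ i = a k * b (i - k) * x ^ (k + (i - k)) := by rw [hki]
    _ = a k * x ^ k * (b (i - k) * x ^ (i - k)) := by rw [pow_add]; ring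

lemma hasSum_abs_delta0 : HasSum (fun i => |delta0 i|) 1 := by
  convert hasSum_ite_eq (0 : ℕ) (1 : ℝ) using 2 with i
  unfold delta0
  split_ifs <;> simp

lemma genFun_delta0 (x : ℝ) : genFun delta0 x = 1 := by
  unfold genFun
  rw [tsum_eq_single 0 fun i hi => by simp [delta0, hi]]
  simp [delta0]

lemma summable_abs_convPow {a : ℕ → ℝ} (ha : Summable fun i => |a i|) (n : ℕ) :
    Summable fun i => |convPow a n i| := by
  induction n with
  | zero => exact hasSum_abs_delta0.summable
  | succ n ih => exact summable_abs_conv ih ha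

lemma l1_convPow_le {a : ℕ → ℝ} (ha : Summable fun i => |a i|) (n : ℕ) :
    l1 (convPow a n) ≤ l1 a ^ n := by
  induction n with
  | zero => exact hasSum_abs_delta0.tsum_eq.le.trans (pow_zero _).ge
  | succ n ih =>
    rw [pow_succ]
    exact (l1_conv_le (summable_abs_convPow ha n) ha).trans
      (mul_le_mul_of_nonneg_right ih (l1_nonneg a))

lemma genFun_convPow {a : ℕ → ℝ} (ha : Summable fun i => |a i|) {x : ℝ} (hx : |x| ≤ 1) (n : ℕ) :
    genFun (convPow a n) x = genFun a x ^ n := by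
  induction n with
  | zero => rw [pow_zero]; exact genFun_delta0 x
  | succ n ih => rw [pow_succ, ← ih]; exact genFun_conv (summable_abs_convPow ha n) ha hx

section ConvSeries

variable {a c : ℕ → ℝ}

lemma tsum_abs_mul_convPow (j : ℕ) : ∑' i, |c j * convPow a j i| = |c j| * l1 (convPow a j) := by
  simp only [abs_mul, tsum_mul_left, l1]

lemma abs_mul_l1_convPow_le (ha : Summable fun i => |a i|) (j : ℕ) :
    |c j| * l1 (convPow a j) ≤ |c j| * l1 a ^ j :=
  mul_le_mul_of_nonneg_left (l1_convPow_le ha j) (abs_nonneg _)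

lemma summable_abs_mul_l1_convPow (ha : Summable fun i => |a i|)
    (hc : Summable fun j => |c j| * l1 a ^ j) : Summable fun j => |c j| * l1 (convPow a j) :=
  Summable.of_nonneg_of_le (fun _ => mul_nonneg (abs_nonneg _) (l1_nonneg _))
    (abs_mul_l1_convPow_le ha) hc

lemma summable_prod_abs_mul_convPow (ha : Summable fun i => |a i|)
    (hc : Summable fun j => |c j| * l1 a ^ j) :
    Summable fun y : ℕ × ℕ => |c y.1 * convPow a y.1 y.2| := by
  refine (summable_prod_of_nonneg fun _ => abs_nonneg _).mpr ⟨fun j => ?_, ?_⟩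
  · simpa only [abs_mul] using (summable_abs_convPow ha j).mul_left |c j|
  · simpa only [tsum_abs_mul_convPow] using summable_abs_mul_l1_convPow ha hc

lemma summable_abs_convSeries (ha : Summable fun i => |a i|)
    (hc : Summable fun j => |c j| * l1 a ^ j) : Summable fun i => |convSeries c a i| := by
  have h := (summable_prod_abs_mul_convPow ha hc).prod_symm
  exact Summable.of_nonneg_of_le (fun _ => abs_nonneg _)
    (fun i => norm_tsum_le_tsum_norm (f := fun j => c j * convPow a j i) (h.prod_factor i)) h.prod

lemma l1_convSeries_le (ha : Summable fun i => |a i|)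
    (hc : Summable fun j => |c j| * l1 a ^ j) : l1 (convSeries c a) ≤ ∑' j, |c j| * l1 a ^ j := by
  have h := summable_prod_abs_mul_convPow ha hc
  calc l1 (convSeries c a) ≤ ∑' i, ∑' j, |c j * convPow a j i| :=
        (summable_abs_convSeries ha hc).tsum_le_tsum
          (fun i => norm_tsum_le_tsum_norm (f := fun j => c j * convPow a j i)
            (h.prod_symm.prod_factor i)) h.prod_symm.prod
    _ = ∑' j, |c j| * l1 (convPow a j) := by
        rw [Summable.tsum_comm (f := fun j i => |c j * convPow a j i|) h]
        simp only [tsum_abs_mul_convPow]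
    _ ≤ ∑' j, |c j| * l1 a ^ j :=
        (summable_abs_mul_l1_convPow ha hc).tsum_le_tsum (abs_mul_l1_convPow_le ha) hc

lemma genFun_convSeries (ha : Summable fun i => |a i|) (hc : Summable fun j => |c j| * l1 a ^ j)
    {x : ℝ} (hx : |x| ≤ 1) : genFun (convSeries c a) x = ∑' j, c j * genFun a x ^ j := by
  have h : Summable fun y : ℕ × ℕ => c y.1 * convPow a y.1 y.2 * x ^ y.2 := by
    refine Summable.of_norm_bounded (summable_prod_abs_mul_convPow ha hc) fun y => ?_
    rw [Real.norm_eq_abs, abs_mul _ (x ^ y.2), abs_pow]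
    exact mul_le_of_le_one_right (abs_nonneg _) (pow_le_one₀ (abs_nonneg _) hx)
  calc genFun (convSeries c a) x = ∑' i, ∑' j, c j * convPow a j i * x ^ i := by
        simp only [genFun, convSeries, tsum_mul_right]
    _ = ∑' j, ∑' i, c j * convPow a j i * x ^ i :=
        Summable.tsum_comm (f := fun j i => c j * convPow a j i * x ^ i) h
    _ = ∑' j, c j * genFun a x ^ j := by
        simp only [← genFun_convPow ha hx, mul_assoc, tsum_mul_left]
        rfl

end ConvSeries

lemma expSeq_eq_convSeries (a : ℕ → ℝ) :
    expSeq a = convSeries (fun j => ((Nat.factorial j : ℝ))⁻¹) a := by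
  funext i
  exact tsum_congr fun j => div_eq_inv_mul _ _

lemma summable_abs_inv_factorial_mul_pow (x : ℝ) :
    Summable fun j : ℕ => |((Nat.factorial j : ℝ))⁻¹| * x ^ j := by
  refine (Real.summable_pow_div_factorial x).congr fun j => ?_
  rw [abs_of_nonneg (by positivity), div_eq_inv_mul]

lemma summable_abs_expSeq {a : ℕ → ℝ} (ha : Summable fun i => |a i|) :
    Summable fun i => |expSeq a i| := by
  rw [expSeq_eq_convSeries]
  exact summable_abs_convSeries ha (summable_abs_inv_factorial_mul_pow _)

lemma genFun_expSeq {a : ℕ → ℝ} (ha : Summable fun i => |a i|) {x : ℝ} (hx : |x| ≤ 1) :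
    genFun (expSeq a) x = Real.exp (genFun a x) := by
  rw [expSeq_eq_convSeries, genFun_convSeries ha (summable_abs_inv_factorial_mul_pow _) hx,
    Real.exp_eq_exp_ℝ, NormedSpace.exp_eq_tsum_div]
  exact tsum_congr fun j => (div_eq_inv_mul _ _).symm

lemma genFun_sub {a b : ℕ → ℝ} (ha : Summable fun i => |a i|) (hb : Summable fun i => |b i|)
    {x : ℝ} (hx : |x| ≤ 1) : genFun (fun i => a i - b i) x = genFun a x - genFun b x := by
  simp only [genFun, sub_mul]
  exact (summable_abs_mul_pow ha hx).of_abs.tsum_sub (summable_abs_mul_pow hb hx).of_abs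

lemma genFun_neg (a : ℕ → ℝ) (x : ℝ) : genFun (fun i => -a i) x = -genFun a x := by
  simp only [genFun, neg_mul, tsum_neg]

lemma summable_abs_sub {a b : ℕ → ℝ} (ha : Summable fun i => |a i|)
    (hb : Summable fun i => |b i|) : Summable fun i => |a i - b i| :=
  (ha.of_abs.sub hb.of_abs).abs

/-- An absolutely summable sequence is determined by its generating function on `[-1, 1]`. -/
lemma eq_of_genFun_eq {a b : ℕ → ℝ} (ha : Summable fun i => |a i|)
    (hb : Summable fun i => |b i|) (h : ∀ x : ℝ, |x| ≤ 1 → genFun a x = genFun b x) : a = b := by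
  have hab := summable_abs_sub ha hb
  have hp : HasFPowerSeriesAt (fun _ : ℝ => (0 : ℝ))
      (FormalMultilinearSeries.ofScalars ℝ fun i => a i - b i) 0 := by
    rw [hasFPowerSeriesAt_iff]
    filter_upwards [Metric.closedBall_mem_nhds (0 : ℝ) one_pos] with x hx
    replace hx : |x| ≤ 1 := by simpa using hx
    have hs := (summable_abs_mul_pow hab hx).of_abs.hasSum
    change HasSum _ (genFun (fun i => a i - b i) x) at hs
    rw [genFun_sub ha hb hx, h x hx, sub_self] at hs
    simpa [FormalMultilinearSeries.coeff_ofScalars, mul_comm] using hs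
  funext i
  have hi := congrArg (fun p => FormalMultilinearSeries.coeff p i) hp.eq_zero
  simp only [FormalMultilinearSeries.coeff_ofScalars] at hi
  exact sub_eq_zero.mp hi

/-- If `exp(a)` and `δ₀ + b` have the same generating function and `‖b‖₁ < 1`, then
`‖a‖₁ ≤ ‖b‖₁ / (1 - ‖b‖₁)`, because `a = log(δ₀ + b)`. -/
lemma l1_le_of_exp_genFun_eq {a b : ℕ → ℝ} (ha : Summable fun i => |a i|)
    (hb : Summable fun i => |b i|) (hb1 : l1 b < 1)
    (h : ∀ x : ℝ, |x| ≤ 1 → Real.exp (genFun a x) = 1 + genFun b x) :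
    l1 a ≤ l1 b / (1 - l1 b) := by
  set c : ℕ → ℝ := fun j => -(-1) ^ j / j with hc_def
  have hle : ∀ j, |c j| * l1 b ^ j ≤ if j = 0 then 0 else l1 b ^ j := by
    intro j
    rcases Nat.eq_zero_or_pos j with rfl | hj
    · simp [hc_def]
    · have hj' : (1 : ℝ) ≤ j := by exact_mod_cast hj
      have hcj : |c j| ≤ 1 := by
        simp only [hc_def, abs_div, abs_neg, abs_pow, abs_one, one_pow, Nat.abs_cast]
        exact (div_le_one (by linarith)).mpr hj'
      rw [if_neg hj.ne']
      exact mul_le_of_le_one_left (pow_nonneg (l1_nonneg b) j) hcj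
  have hgeom : HasSum (fun j => if j = 0 then 0 else l1 b ^ j) (l1 b / (1 - l1 b)) := by
    rw [← hasSum_nat_add_iff' 1]
    simpa [pow_succ', div_eq_mul_inv] using
      (hasSum_geometric_of_lt_one (l1_nonneg b) hb1).mul_left (l1 b)
  have hc : Summable fun j => |c j| * l1 b ^ j :=
    Summable.of_nonneg_of_le (fun j => mul_nonneg (abs_nonneg _) (pow_nonneg (l1_nonneg b) j))
      hle hgeom.summable
  have hlog : a = convSeries c b := by
    refine eq_of_genFun_eq ha (summable_abs_convSeries hb hc) fun x hx => ?_
    have hbx : |-genFun b x| < 1 := by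
      rw [abs_neg]
      exact (abs_genFun_le hb hx).trans_lt hb1
    have hs := (Real.hasSum_pow_div_log_of_abs_lt_one hbx).neg
    rw [neg_neg, sub_neg_eq_add, ← h x hx, Real.log_exp] at hs
    rw [genFun_convSeries hb hc hx, tsum_eq_zero_add' ?_, ← hs.tsum_eq]
    · simp only [hc_def, Nat.cast_zero, div_zero, zero_mul, zero_add]
      refine tsum_congr fun j => ?_
      rw [neg_pow (genFun b x)]
      push_cast
      ring
    · refine hs.summable.congr fun j => ?_
      simp only [hc_def]
      rw [neg_pow (genFun b x)]
      push_cast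
      ring
  rw [hlog]
  exact (l1_convSeries_le hb hc).trans ((hc.tsum_le_tsum hle hgeom.summable).trans hgeom.tsum_eq.le)

/-- The exponential has a locally Lipschitz inverse on `ℓ¹`. -/
lemma l1_sub_lt_of_l1_expSeq_sub_lt {a a₀ : ℕ → ℝ} (ha : Summable fun i => |a i|)
    (ha₀ : Summable fun i => |a₀ i|) {ε : ℝ} (hε1 : ε ≤ 1)
    (h : l1 (fun i => expSeq a i - expSeq a₀ i) * l1 (expSeq fun j => -a₀ j) < ε / 2) :
    l1 (fun i => a i - a₀ i) < ε := by
  have hd := summable_abs_sub (summable_abs_expSeq ha) (summable_abs_expSeq ha₀)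
  have hneg : Summable fun i => |-a₀ i| := by simpa only [abs_neg] using ha₀
  have hr := summable_abs_expSeq hneg
  set b := conv (fun i => expSeq a i - expSeq a₀ i) (expSeq fun j => -a₀ j)
  have hb : l1 b < ε / 2 := (l1_conv_le hd hr).trans_lt h
  have hb0 := l1_nonneg b
  refine (l1_le_of_exp_genFun_eq (summable_abs_sub ha ha₀) (summable_abs_conv hd hr)
    (by linarith) fun x hx => ?_).trans_lt ?_
  · rw [genFun_conv hd hr hx, genFun_sub (summable_abs_expSeq ha) (summable_abs_expSeq ha₀) hx,
      genFun_expSeq ha hx, genFun_expSeq ha₀ hx, genFun_expSeq hneg hx, genFun_neg,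
      genFun_sub ha ha₀ hx, sub_mul, ← Real.exp_add, ← Real.exp_add, add_neg_cancel, Real.exp_zero,
      sub_eq_add_neg]
    ring
  · rw [div_lt_iff₀ (by linarith)]
    nlinarith

lemma IsPMF.summable_abs {p : ℕ → ℝ} (hp : IsPMF p) : Summable fun i => |p i| := by
  refine Summable.abs (of_not_not fun hs => ?_)
  have h := hp.2
  rw [tsum_eq_zero_of_not_summable hs] at h
  exact zero_ne_one h

lemma IsPMF.summable_abs_mul_sub_delta0 {p : ℕ → ℝ} (hp : IsPMF p) (lam : ℝ) :
    Summable fun i => |lam * (p i - delta0 i)| :=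
  ((summable_abs_sub hp.summable_abs hasSum_abs_delta0.summable).of_abs.mul_left lam).abs

lemma l1_mul_sub_mul_le {p p₀ : ℕ → ℝ} (hp : IsPMF p) (hp₀ : IsPMF p₀) (h0 : p 0 = 0)
    (h00 : p₀ 0 = 0) (lam lam₀ : ℝ) :
    l1 (fun i => lam * p i - lam₀ * p₀ i) ≤
      l1 (fun i => lam * (p i - delta0 i) - lam₀ * (p₀ i - delta0 i)) := by
  refine Summable.tsum_le_tsum (fun i => ?_)
    ((hp.summable_abs.of_abs.mul_left lam).sub (hp₀.summable_abs.of_abs.mul_left lam₀)).abs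
    (summable_abs_sub (hp.summable_abs_mul_sub_delta0 lam)
      (hp₀.summable_abs_mul_sub_delta0 lam₀))
  rcases eq_or_ne i 0 with rfl | hi
  · simp [h0, h00]
  · simp [delta0, hi]

/-- Basic posterior inequality: for any probability measure Π on pairs (λ, p) and
any ε ∈ (0,1], Π(‖ν − ν₀‖₁ ≥ ε) ≤ 2 Π(‖q_{λ,p} − q₀‖₁ ≥ ε/(2‖r₀‖₁)). -/
theorem stmt3 (lam₀ : ℝ) (hlam₀ : 0 < lam₀) (p₀ : ℕ → ℝ) (hp₀ : IsPMF p₀) (h00 : p₀ 0 = 0)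
    (μ : Measure {x : ℝ × (ℕ → ℝ) // 0 < x.1 ∧ IsPMF x.2 ∧ x.2 0 = 0})
    [IsProbabilityMeasure μ] (ε : ℝ) (hε : 0 < ε) (hε1 : ε ≤ 1) :
    μ {x | ε ≤ l1 (fun i => x.val.1 * x.val.2 i - lam₀ * p₀ i)} ≤
      2 * μ {x | ε / (2 * l1 (expSeq (fun j => -(lam₀ * (p₀ j - delta0 j))))) ≤
        l1 (fun i => expSeq (fun j => x.val.1 * (x.val.2 j - delta0 j)) i -
          expSeq (fun j => lam₀ * (p₀ j - delta0 j)) i)} := by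
  refine (measure_mono fun x hx => ?_).trans (le_mul_of_one_le_left' one_le_two)
  obtain ⟨⟨lam, p⟩, hlam, hp, h0⟩ := x
  simp only [Set.mem_ofPred_eq] at hx ⊢
  by_contra! hlt
  refine hx.not_gt ((l1_mul_sub_mul_le hp hp₀ h0 h00 lam lam₀).trans_lt
    (l1_sub_lt_of_l1_expSeq_sub_lt (hp.summable_abs_mul_sub_delta0 lam)
      (hp₀.summable_abs_mul_sub_delta0 lam₀) hε1 ?_))
  set R := l1 (expSeq fun j => -(lam₀ * (p₀ j - delta0 j)))
  have hR0 : 0 ≤ R := l1_nonneg _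
  change _ * R < _
  rcases hR0.eq_or_lt with hR | hR
  · rw [← hR, mul_zero]
    exact half_pos hε
  · rw [lt_div_iff₀ (mul_pos two_pos hR)] at hlt
    linarith
end
end

section
/- Let 0 < Λ̲ ≤ Λ̄ < ∞, m ∈ ℕ with m ≥ 1, let λ, λ′ ∈ [Λ̲, Λ̄], and let p, p′ be probability mass functions supported on {1, …, m}. Then h(q_{λ,p}, q_{λ′,p′}) ≤ √(Λ̄ · m · ‖p − p′‖_∞) + |λ − λ′|/(2√Λ̲), where ‖p − p′‖_∞ = max_{1 ≤ i ≤ m} |p(i) − p′(i)|. -/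
open MeasureTheory
open scoped BigOperators Classical

noncomputable section

lemma conv_nonneg {a b : ℕ → ℝ} (ha : ∀ i, 0 ≤ a i) (hb : ∀ i, 0 ≤ b i) (i : ℕ) :
    0 ≤ conv a b i :=
  Finset.sum_nonneg fun _ _ => mul_nonneg (ha _) (hb _)

lemma hasSum_conv {a b : ℕ → ℝ} {A B : ℝ} (hA : HasSum a A) (hB : HasSum b B) :
    HasSum (conv a b) (A * B) := by
  have := hasSum_sum_range_mul_of_summable_norm (f := a) (g := b) hA.summable.norm
    hB.summable.norm
  rwa [hA.tsum_eq, hB.tsum_eq] at this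

lemma delta0_nonneg (i : ℕ) : 0 ≤ delta0 i := by
  unfold delta0
  split_ifs <;> norm_num

lemma convPow_nonneg {a : ℕ → ℝ} (ha : ∀ i, 0 ≤ a i) (n : ℕ) : ∀ i, 0 ≤ convPow a n i := by
  induction n with
  | zero => exact delta0_nonneg
  | succ n ih => exact conv_nonneg ih ha

lemma hasSum_convPow {a : ℕ → ℝ} {A : ℝ} (hA : HasSum a A) (n : ℕ) :
    HasSum (convPow a n) (A ^ n) := by
  induction n with
  | zero =>
    rw [pow_zero]
    exact hasSum_ite_eq (0 : ℕ) (1 : ℝ)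
  | succ n ih =>
    rw [pow_succ]
    exact hasSum_conv ih hA

/-- Cauchy–Schwarz for convolutions of square roots. -/
lemma conv_sqrt_mul_sqrt_le {a a' b b' r s : ℕ → ℝ} (ha : ∀ i, 0 ≤ a i) (ha' : ∀ i, 0 ≤ a' i)
    (hb : ∀ i, 0 ≤ b i) (hb' : ∀ i, 0 ≤ b' i) (hs : ∀ i, 0 ≤ s i)
    (hr : ∀ i, r i ≤ √(a i) * √(a' i)) (hs' : ∀ i, s i ≤ √(b i) * √(b' i)) (i : ℕ) :
    conv r s i ≤ √(conv a b i) * √(conv a' b' i) := by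
  refine le_trans (Finset.sum_le_sum fun k _ => ?_)
    (Real.sum_sqrt_mul_sqrt_le (Finset.range (i + 1))
      (fun k => mul_nonneg (ha k) (hb (i - k))) (fun k => mul_nonneg (ha' k) (hb' (i - k))))
  rw [Real.sqrt_mul (ha k), Real.sqrt_mul (ha' k), mul_mul_mul_comm]
  exact mul_le_mul (hr k) (hs' (i - k)) (hs _) (by positivity)

lemma convPow_sqrt_mul_sqrt_le {p p' : ℕ → ℝ} (hp : ∀ i, 0 ≤ p i) (hp' : ∀ i, 0 ≤ p' i) (n : ℕ) :
    ∀ i, convPow (fun i => √(p i) * √(p' i)) n i ≤ √(convPow p n i) * √(convPow p' n i) := by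
  induction n with
  | zero => exact fun i => (Real.mul_self_sqrt (delta0_nonneg i)).ge
  | succ n ih =>
    exact conv_sqrt_mul_sqrt_le (convPow_nonneg hp n) (convPow_nonneg hp' n) hp hp'
      (fun i => by positivity) ih fun i => le_rfl

/-- Cauchy–Schwarz for series of square roots. -/
lemma tsum_sqrt_mul_sqrt_le {a b c : ℕ → ℝ} (ha : ∀ n, 0 ≤ a n) (hb : ∀ n, 0 ≤ b n)
    (hc : ∀ n, 0 ≤ c n) (hsa : Summable a) (hsb : Summable b)
    (h : ∀ n, c n ≤ √(a n) * √(b n)) : ∑' n, c n ≤ √(∑' n, a n) * √(∑' n, b n) := by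
  refine Real.tsum_le_of_sum_le hc fun s => ?_
  calc ∑ n ∈ s, c n ≤ ∑ n ∈ s, √(a n) * √(b n) := Finset.sum_le_sum fun n _ => h n
    _ ≤ √(∑ n ∈ s, a n) * √(∑ n ∈ s, b n) := Real.sum_sqrt_mul_sqrt_le s ha hb
    _ ≤ √(∑' n, a n) * √(∑' n, b n) := by
      gcongr
      · exact hsa.sum_le_tsum s fun n _ => ha n
      · exact hsb.sum_le_tsum s fun n _ => hb n

/-- Interchange of summation for nonnegative double series. -/
lemma hasSum_tsum_comm_of_nonneg {f : ℕ → ℕ → ℝ} {s : ℕ → ℝ} {S : ℝ} (hf : ∀ n i, 0 ≤ f n i)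
    (hs : ∀ n, HasSum (f n) (s n)) (hS : HasSum s S) :
    (∀ i, Summable fun n => f n i) ∧ HasSum (fun i => ∑' n, f n i) S := by
  have hsum : Summable (Function.uncurry f) := by
    refine (summable_prod_of_nonneg fun x => hf x.1 x.2).2 ⟨fun n => (hs n).summable, ?_⟩
    simpa only [Function.uncurry_apply_pair, (hs _).tsum_eq] using hS.summable
  have hval : HasSum (Function.uncurry f) S := by
    have := hsum.hasSum.prod_fiberwise hs
    rw [← this.unique hS]
    exact hsum.hasSum
  have hswap : HasSum (fun x : ℕ × ℕ => f x.2 x.1) S := (Equiv.prodComm ℕ ℕ).hasSum_iff.2 hval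
  have hfib (i : ℕ) : Summable fun n => f n i := hswap.summable.prod_factor i
  exact ⟨hfib, hswap.prod_fiberwise fun i => (hfib i).hasSum⟩

/-- Poisson mixtures of convolution powers: fibrewise summability and total mass. -/
lemma hasSum_poisson_mixture {a : ℕ → ℝ} {A C μ : ℝ} (ha : ∀ i, 0 ≤ a i) (hA : HasSum a A)
    (hC : 0 ≤ C) (hμ : 0 ≤ μ) :
    (∀ i, Summable fun n => C * μ ^ n / (Nat.factorial n : ℝ) * convPow a n i) ∧
      HasSum (fun i => ∑' n, C * μ ^ n / (Nat.factorial n : ℝ) * convPow a n i)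
        (C * Real.exp (μ * A)) := by
  refine hasSum_tsum_comm_of_nonneg
    (f := fun n i => C * μ ^ n / (Nat.factorial n : ℝ) * convPow a n i)
    (fun n i => mul_nonneg (by positivity) (convPow_nonneg ha n i))
    (fun n => (hasSum_convPow hA n).mul_left _) ?_
  have h := (NormedSpace.expSeries_div_hasSum_exp (μ * A)).mul_left C
  rw [← Real.exp_eq_exp_ℝ] at h
  convert! h using 2 with n
  rw [mul_pow]
  ring

lemma hasSum_cpq {lam : ℝ} {p : ℕ → ℝ} (hlam : 0 ≤ lam) (hp : ∀ i, 0 ≤ p i) (hp1 : HasSum p 1) :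
    HasSum (cpq lam p) 1 := by
  have h := (hasSum_poisson_mixture hp hp1 (Real.exp_pos (-lam)).le hlam).2
  rwa [mul_one, ← Real.exp_add, neg_add_cancel, Real.exp_zero] at h

lemma cpq_nonneg {lam : ℝ} {p : ℕ → ℝ} (hlam : 0 ≤ lam) (hp : ∀ i, 0 ≤ p i) (i : ℕ) :
    0 ≤ cpq lam p i :=
  tsum_nonneg fun n => mul_nonneg (by positivity) (convPow_nonneg hp n i)

lemma sqrt_poisson_mul_sqrt_poisson {lam lam' : ℝ} (hlam : 0 ≤ lam) (hlam' : 0 ≤ lam') (n : ℕ) :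
    √(Real.exp (-lam) * lam ^ n / (Nat.factorial n : ℝ)) *
        √(Real.exp (-lam') * lam' ^ n / (Nat.factorial n : ℝ)) =
      Real.exp (-(lam + lam') / 2) * (√lam * √lam') ^ n / (Nat.factorial n : ℝ) := by
  rw [← Real.sqrt_mul (by positivity), Real.sqrt_eq_iff_mul_self_eq (by positivity) (by positivity)]
  have he : Real.exp (-(lam + lam') / 2) * Real.exp (-(lam + lam') / 2) =
      Real.exp (-lam) * Real.exp (-lam') := by
    rw [← Real.exp_add, ← Real.exp_add]
    ring_nf
  have hs : (√lam * √lam') ^ n * (√lam * √lam') ^ n = lam ^ n * lam' ^ n := by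
    rw [← mul_pow, ← mul_pow, mul_mul_mul_comm, Real.mul_self_sqrt hlam, Real.mul_self_sqrt hlam']
  rw [div_mul_div_comm, div_mul_div_comm, mul_mul_mul_comm, ← he, ← hs, mul_mul_mul_comm]

lemma sqrt_sub_sqrt_sq {x y : ℝ} (hx : 0 ≤ x) (hy : 0 ≤ y) :
    (√x - √y) ^ 2 = x + y - 2 * (√x * √y) := by
  rw [sub_sq, Real.sq_sqrt hx, Real.sq_sqrt hy]
  ring

/-- The squared Hellinger distance of compound Poisson distributions, in terms of the affinity
`ρ` of the jump distributions. -/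
lemma hellSq_cpq_le {lam lam' ρ : ℝ} {p p' : ℕ → ℝ} (hlam : 0 ≤ lam) (hlam' : 0 ≤ lam')
    (hp : ∀ i, 0 ≤ p i) (hp' : ∀ i, 0 ≤ p' i) (hp1 : HasSum p 1) (hp'1 : HasSum p' 1)
    (hρ : HasSum (fun i => √(p i) * √(p' i)) ρ) :
    hellSq (cpq lam p) (cpq lam' p') ≤ (√lam - √lam') ^ 2 + √lam * √lam' * (2 - 2 * ρ) := by
  obtain ⟨-, hg⟩ := hasSum_poisson_mixture (fun i => by positivity) hρ
    (Real.exp_pos (-(lam + lam') / 2)).le (by positivity : 0 ≤ √lam * √lam')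
  rw [← Real.exp_add] at hg
  have hterm (i : ℕ) := tsum_sqrt_mul_sqrt_le
    (fun n => mul_nonneg (by positivity) (convPow_nonneg hp n i))
    (fun n => mul_nonneg (by positivity) (convPow_nonneg hp' n i))
    (fun n => mul_nonneg (by positivity) (convPow_nonneg (fun i => by positivity) n i))
    ((hasSum_poisson_mixture hp hp1 (Real.exp_pos (-lam)).le hlam).1 i)
    ((hasSum_poisson_mixture hp' hp'1 (Real.exp_pos (-lam')).le hlam').1 i)
    (c := fun n => Real.exp (-(lam + lam') / 2) * (√lam * √lam') ^ n / (Nat.factorial n : ℝ) *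
      convPow (fun i => √(p i) * √(p' i)) n i)
    (fun n => by
      rw [Real.sqrt_mul (by positivity), Real.sqrt_mul (by positivity), mul_mul_mul_comm,
        sqrt_poisson_mul_sqrt_poisson hlam hlam']
      exact mul_le_mul_of_nonneg_left (convPow_sqrt_mul_sqrt_le hp hp' n i) (by positivity))
  have hle (i : ℕ) := (sqrt_sub_sqrt_sq (cpq_nonneg hlam hp i) (cpq_nonneg hlam' hp' i)).le.trans
    (sub_le_sub_left (mul_le_mul_of_nonneg_left (hterm i) zero_le_two) _)
  have hbound := ((hasSum_cpq hlam hp hp1).add (hasSum_cpq hlam' hp' hp'1)).sub (hg.mul_left 2)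
  have hsum := Summable.of_nonneg_of_le (fun i => sq_nonneg _) hle hbound.summable
  have hh : hellSq (cpq lam p) (cpq lam' p') ≤ _ := hasSum_le hle hsum.hasSum hbound
  have hexp := Real.add_one_le_exp (-(lam + lam') / 2 + √lam * √lam' * ρ)
  rw [sqrt_sub_sqrt_sq hlam hlam']
  linarith

lemma sqrt_sub_sqrt_sq_le_abs_sub {x y : ℝ} (hx : 0 ≤ x) (hy : 0 ≤ y) :
    (√x - √y) ^ 2 ≤ |x - y| := by
  have hfac : x - y = (√x - √y) * (√x + √y) := by
    rw [mul_comm, ← sq_sub_sq, Real.sq_sqrt hx, Real.sq_sqrt hy]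
  rw [hfac, abs_mul, ← sq_abs, sq, abs_of_nonneg (by positivity : 0 ≤ √x + √y)]
  refine mul_le_mul_of_nonneg_left (abs_le.2 ⟨?_, ?_⟩) (abs_nonneg _) <;>
    linarith [Real.sqrt_nonneg x, Real.sqrt_nonneg y]

lemma abs_sqrt_sub_sqrt_le {x y c : ℝ} (hc : 0 < c) (hx : c ≤ x) (hy : c ≤ y) :
    |√x - √y| ≤ |x - y| / (2 * √c) := by
  have hc' := Real.sqrt_pos.2 hc
  have hfac : x - y = (√x - √y) * (√x + √y) := by
    rw [mul_comm, ← sq_sub_sq, Real.sq_sqrt (hc.le.trans hx), Real.sq_sqrt (hc.le.trans hy)]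
  rw [le_div_iff₀ (by positivity), hfac, abs_mul, abs_of_nonneg (by positivity : 0 ≤ √x + √y)]
  refine mul_le_mul_of_nonneg_left ?_ (abs_nonneg _)
  linarith [Real.sqrt_le_sqrt hx, Real.sqrt_le_sqrt hy]

/-- h(q_{λ,p}, q_{λ′,p′}) ≤ √(Λ̄·m·‖p − p′‖_∞) + |λ − λ′|/(2√Λ̲) for
λ, λ′ ∈ [Λ̲, Λ̄] and p, p′ supported on {1,…,m}. -/
theorem stmt5 (Λlo Λhi : ℝ) (h1 : 0 < Λlo) (h2 : Λlo ≤ Λhi) (m : ℕ) (hm : 1 ≤ m)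
    (lam lam' : ℝ) (hl : lam ∈ Set.Icc Λlo Λhi) (hl' : lam' ∈ Set.Icc Λlo Λhi)
    (p p' : ℕ → ℝ) (hp : IsPMF p) (hp' : IsPMF p')
    (hp0 : p 0 = 0) (hps : ∀ i, m < i → p i = 0)
    (hp'0 : p' 0 = 0) (hp's : ∀ i, m < i → p' i = 0) :
    hell (cpq lam p) (cpq lam' p') ≤
      Real.sqrt (Λhi * m *
        (Finset.Icc 1 m).sup' (Finset.nonempty_Icc.mpr hm) (fun i => |p i - p' i|)) +
      |lam - lam'| / (2 * Real.sqrt Λlo) := by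
  set M := (Finset.Icc 1 m).sup' (Finset.nonempty_Icc.mpr hm) (fun i => |p i - p' i|)
  have hlam : 0 ≤ lam := h1.le.trans hl.1
  have hlam' : 0 ≤ lam' := h1.le.trans hl'.1
  have hout {a : ℕ → ℝ} (ha0 : a 0 = 0) (ha : ∀ i, m < i → a i = 0) (i : ℕ)
      (hi : i ∉ Finset.Icc 1 m) : a i = 0 := by
    rcases Nat.eq_zero_or_pos i with rfl | hpos
    · exact ha0
    · exact ha i (by simp only [Finset.mem_Icc, not_and, not_le] at hi; exact hi hpos)
  have hpS : HasSum p _ := hasSum_sum_of_ne_finset_zero (hout hp0 hps)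
  have hp'S : HasSum p' _ := hasSum_sum_of_ne_finset_zero (hout hp'0 hp's)
  have hρ := hasSum_sum_of_ne_finset_zero (f := fun i => √(p i) * √(p' i)) (s := Finset.Icc 1 m)
    (L := SummationFilter.unconditional ℕ) fun i hi => by simp [hout hp0 hps i hi]
  have hp1 : HasSum p 1 := hp.2 ▸ hpS.summable.hasSum
  have hp'1 : HasSum p' 1 := hp'.2 ▸ hp'S.summable.hasSum
  have hM : 2 - 2 * ∑ i ∈ Finset.Icc 1 m, √(p i) * √(p' i) ≤ m * M := by
    calc 2 - 2 * ∑ i ∈ Finset.Icc 1 m, √(p i) * √(p' i)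
        = ∑ i ∈ Finset.Icc 1 m, (√(p i) - √(p' i)) ^ 2 := by
          simp_rw [fun i => sqrt_sub_sqrt_sq (hp.1 i) (hp'.1 i)]
          rw [Finset.sum_sub_distrib, Finset.sum_add_distrib, ← Finset.mul_sum,
            hpS.unique hp1, hp'S.unique hp'1]
          norm_num
      _ ≤ ∑ _i ∈ Finset.Icc 1 m, M := Finset.sum_le_sum fun i hi =>
          (sqrt_sub_sqrt_sq_le_abs_sub (hp.1 i) (hp'.1 i)).trans
            (Finset.le_sup' (fun i => |p i - p' i|) hi)
      _ = m * M := by simp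
  have hM0 : 0 ≤ M := (abs_nonneg _).trans
    (Finset.le_sup' (fun i => |p i - p' i|) (Finset.mem_Icc.2 ⟨le_rfl, hm⟩))
  have hΛ : √lam * √lam' ≤ Λhi := by
    rw [← Real.mul_self_sqrt (h1.le.trans h2)]
    exact mul_le_mul (Real.sqrt_le_sqrt hl.2) (Real.sqrt_le_sqrt hl'.2) (by positivity)
      (by positivity)
  have hprod : √lam * √lam' * (2 - 2 * ∑ i ∈ Finset.Icc 1 m, √(p i) * √(p' i)) ≤ Λhi * m * M := by
    rw [mul_assoc Λhi]
    exact (mul_le_mul_of_nonneg_left hM (by positivity)).trans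
      (mul_le_mul_of_nonneg_right hΛ (by positivity))
  have hsq := abs_sqrt_sub_sqrt_le h1 hl.1 hl'.1
  have hΛhi : 0 ≤ Λhi * m * M := by have := h1.le.trans h2; positivity
  have hh := hellSq_cpq_le hlam hlam' hp.1 hp'.1 hp1 hp'1 hρ
  calc hell (cpq lam p) (cpq lam' p') ≤ √(Λhi * m * M + (√lam - √lam') ^ 2) :=
        Real.sqrt_le_sqrt (by linarith)
    _ ≤ √(Λhi * m * M) + |√lam - √lam'| := by
      rw [Real.sqrt_le_left (by positivity), add_sq, Real.sq_sqrt hΛhi, sq_abs]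
      exact add_le_add_left (le_add_of_nonneg_right (by positivity)) _
    _ ≤ _ := by gcongr
end
end

section
/- Let p, p′ : ℕ → ℝ be probability mass functions with p(0) = p′(0) = 0. Then for every n ≥ 1, h²(p^{∗n}, p′^{∗n}) ≤ n · h²(p, p′), where h is the Hellinger distance. -/
open MeasureTheory
open scoped BigOperators Classical

noncomputable section

/-- The Hellinger affinity (Bhattacharyya coefficient) of two sequences. -/
def hellAffinity (u v : ℕ → ℝ) : ℝ := ∑' i, √(u i) * √(v i)

theorem IsPMF.summable {p : ℕ → ℝ} (hp : IsPMF p) : Summable p := by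
  by_contra h
  have h1 := hp.2
  rw [tsum_eq_zero_of_not_summable h] at h1
  exact zero_ne_one h1

theorem IsPMF.delta0 : IsPMF delta0 := by
  refine ⟨fun i => ?_, ?_⟩
  · unfold _root_.delta0
    split_ifs <;> norm_num
  · exact tsum_ite_eq 0 (fun _ => (1 : ℝ))

theorem IsPMF.conv {p q : ℕ → ℝ} (hp : IsPMF p) (hq : IsPMF q) : IsPMF (conv p q) := by
  refine ⟨fun i => Finset.sum_nonneg fun k _ => mul_nonneg (hp.1 k) (hq.1 _), ?_⟩
  have h := tsum_mul_tsum_eq_tsum_sum_range_of_summable_norm hp.summable.norm hq.summable.norm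
  rw [hp.2, hq.2, one_mul] at h
  exact h.symm

theorem IsPMF.convPow {p : ℕ → ℝ} (hp : IsPMF p) (n : ℕ) : IsPMF (convPow p n) := by
  induction n with
  | zero => exact IsPMF.delta0
  | succ n ih => exact ih.conv hp

theorem IsPMF.summable_sqrt_mul_sqrt {u v : ℕ → ℝ} (hu : IsPMF u) (hv : IsPMF v) :
    Summable fun i => √(u i) * √(v i) := by
  refine Summable.of_nonneg_of_le (fun i => by positivity) (fun i => ?_)
    (hu.summable.add hv.summable)
  nlinarith [sq_nonneg (√(u i) - √(v i)), Real.sq_sqrt (hu.1 i), Real.sq_sqrt (hv.1 i),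
    hu.1 i, hv.1 i]

theorem hellSq_nonneg (u v : ℕ → ℝ) : 0 ≤ hellSq u v :=
  tsum_nonneg fun _ => sq_nonneg _

theorem hell_sq (u v : ℕ → ℝ) : hell u v ^ 2 = hellSq u v :=
  Real.sq_sqrt (hellSq_nonneg u v)

theorem hellSq_eq_two_sub_hellAffinity {u v : ℕ → ℝ} (hu : IsPMF u) (hv : IsPMF v) :
    hellSq u v = 2 - 2 * hellAffinity u v := by
  have h : ∀ i, (√(u i) - √(v i)) ^ 2 = u i + v i - 2 * (√(u i) * √(v i)) := fun i => by
    rw [sub_sq, Real.sq_sqrt (hu.1 i), Real.sq_sqrt (hv.1 i)]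
    ring
  unfold hellSq hellAffinity
  rw [tsum_congr h, (hu.summable.add hv.summable).tsum_sub
    ((hu.summable_sqrt_mul_sqrt hv).mul_left 2), hu.summable.tsum_add hv.summable,
    tsum_mul_left, hu.2, hv.2]
  norm_num

theorem hellAffinity_le_one {u v : ℕ → ℝ} (hu : IsPMF u) (hv : IsPMF v) :
    hellAffinity u v ≤ 1 := by
  linarith [hellSq_nonneg u v, hellSq_eq_two_sub_hellAffinity hu hv]

/-- The affinity is supermultiplicative under convolution, by Cauchy–Schwarz. -/
theorem hellAffinity_mul_le_conv {a b c d : ℕ → ℝ} (ha : IsPMF a) (hb : IsPMF b)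
    (hc : IsPMF c) (hd : IsPMF d) :
    hellAffinity a c * hellAffinity b d ≤ hellAffinity (conv a b) (conv c d) := by
  have hac := (ha.summable_sqrt_mul_sqrt hc).norm
  have hbd := (hb.summable_sqrt_mul_sqrt hd).norm
  unfold hellAffinity
  rw [tsum_mul_tsum_eq_tsum_sum_range_of_summable_norm hac hbd]
  refine Summable.tsum_le_tsum (fun i => ?_)
    (summable_norm_sum_mul_range_of_summable_norm hac hbd).of_norm
    ((ha.conv hb).summable_sqrt_mul_sqrt (hc.conv hd))
  refine le_trans (le_of_eq (Finset.sum_congr rfl fun k _ => ?_))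
    (Real.sum_sqrt_mul_sqrt_le (Finset.range (i + 1))
      (fun k => mul_nonneg (ha.1 k) (hb.1 (i - k))) (fun k => mul_nonneg (hc.1 k) (hd.1 (i - k))))
  rw [Real.sqrt_mul (ha.1 k), Real.sqrt_mul (hc.1 k)]
  ring

theorem hellSq_conv_le {a b c d : ℕ → ℝ} (ha : IsPMF a) (hb : IsPMF b)
    (hc : IsPMF c) (hd : IsPMF d) :
    hellSq (conv a b) (conv c d) ≤ hellSq a c + hellSq b d := by
  rw [hellSq_eq_two_sub_hellAffinity (ha.conv hb) (hc.conv hd),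
    hellSq_eq_two_sub_hellAffinity ha hc, hellSq_eq_two_sub_hellAffinity hb hd]
  nlinarith [hellAffinity_mul_le_conv ha hb hc hd, mul_nonneg
    (sub_nonneg.2 (hellAffinity_le_one ha hc)) (sub_nonneg.2 (hellAffinity_le_one hb hd))]

theorem hellSq_convPow_le {p p' : ℕ → ℝ} (hp : IsPMF p) (hp' : IsPMF p') (n : ℕ) :
    hellSq (convPow p n) (convPow p' n) ≤ n * hellSq p p' := by
  induction n with
  | zero => simp [convPow, hellSq]
  | succ n ih =>
    push_cast
    linarith [hellSq_conv_le (hp.convPow n) hp (hp'.convPow n) hp',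
      show hellSq (convPow p (n + 1)) (convPow p' (n + 1)) =
        hellSq (conv (convPow p n) p) (conv (convPow p' n) p') from rfl]

/-- h²(p^{∗n}, p′^{∗n}) ≤ n · h²(p, p′). -/
theorem stmt10 (p p' : ℕ → ℝ) (hp : IsPMF p) (hp' : IsPMF p')
    (h0 : p 0 = 0) (h0' : p' 0 = 0) :
    ∀ n : ℕ, 1 ≤ n → (hell (convPow p n) (convPow p' n)) ^ 2 ≤ n * (hell p p') ^ 2 := by
  intro n _
  rw [hell_sq, hell_sq]
  exact hellSq_convPow_le hp hp' n
end
end
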